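/- Let the edges of the complete graph K_n be 2-locally coloured (every vertex is incident to edges of at most 2 distinct colours) and suppose there is a colour α such that every vertex is incident to at least one edge of colour α. Then there are two disjoint monochromatic cycles of different colours, one of them of colour α, that together cover all vertices of K_n. -/

import Mathlib

/-- `S` is the vertex set of a monochromatic cycle of colour `col` in the complete graph
`K_n` coloured by `χ`; the empty set, single vertices and single edges count as degenerate
cycles (the empty set being a cycle of any colour). -/
def IsMonoCycle {n : ℕ} (χ : Fin n → Fin n → ℕ) (col : ℕ) (S : Finset (Fin n)) : Prop :=
  S = ∅ ∨
  (∃ v, S = {v}) ∨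
  (∃ v w : Fin n, v ≠ w ∧ S = {v, w} ∧ χ v w = col) ∨
  (∃ (v : Fin n) (p : (⊤ : SimpleGraph (Fin n)).Walk v v),
    p.IsCycle ∧ p.support.toFinset = S ∧ ∀ x y : Fin n, s(x, y) ∈ p.edges → χ x y = col)


namespace Lehel

inductive W {V : Type} (Q : V → V → Prop) : V → V → Multiset V → Prop
  | one (a : V) : W Q a a {a}
  | cons {a b c : V} {M : Multiset V} : Q a b → W Q b c M → W Q a c ({a} + M)

variable {V : Type} {R Q : V → V → Prop} {U : Multiset V} {m : ℕ}

theorem W.cast {a b : V} {M M' : Multiset V} (h : W Q a b M) (e : M = M') : W Q a b M' := e ▸ h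

theorem W.cast3 {a b a' b' : V} {M M' : Multiset V} (h : W Q a b M) (ea : a = a') (eb : b = b')
    (e : M = M') : W Q a' b' M' := by subst ea eb e; exact h

theorem W.app {a b c d : V} {M M' : Multiset V} (h : W Q a b M) (e : Q b c) (h' : W Q c d M') :
    W Q a d (M + M') := by
  induction h with
  | one a => exact W.cons e h'
  | cons h1 _ ih => rw [add_assoc]; exact W.cons h1 (ih e)

theorem W.snoc {a b c : V} {M : Multiset V} (h : W Q a b M) (e : Q b c) :
    W Q a c (M + {c}) := h.app e (W.one c)

theorem W.rev (hs : ∀ a b, Q a b → Q b a) {a b : V} {M : Multiset V} (h : W Q a b M) :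
    W Q b a M := by
  induction h with
  | one a => exact W.one a
  | cons h1 _ ih => exact (ih.snoc (hs _ _ h1)).cast (add_comm _ _)

def Cyc (Q : V → V → Prop) (M : Multiset V) : Prop :=
  M = 0 ∨ (∃ a, M = {a}) ∨ ∃ a b, W Q a b M ∧ Q b a

def Fine (R : V → V → Prop) (U : Multiset V) : Prop :=
  ∃ M₁ M₂, M₁ + M₂ = U ∧ Cyc R M₁ ∧ Cyc (fun a b => ¬ R a b) M₂

def arc (f : ℕ → V) (i n : ℕ) : Multiset V := ∑ j ∈ Finset.range n, {f (i + j)}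

theorem arc_zero (f : ℕ → V) (i : ℕ) : arc f i 0 = 0 := by simp [arc]

theorem arc_one (f : ℕ → V) (i : ℕ) : arc f i 1 = {f i} := by simp [arc]

theorem arc_succ (f : ℕ → V) (i n : ℕ) : arc f i (n+1) = arc f i n + {f (i+n)} := by
  simp [arc, Finset.sum_range_succ]

theorem arc_succ' (f : ℕ → V) (i n : ℕ) : arc f i (n+1) = {f i} + arc f (i+1) n := by
  simp only [arc, Finset.sum_range_succ']
  rw [add_comm]
  simp only [add_zero]
  congr 1
  apply Finset.sum_congr rfl
  intro j _
  rw [show i + (j+1) = i+1+j by omega]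

theorem arc_card (f : ℕ → V) (i n : ℕ) : Multiset.card (arc f i n) = n := by
  simp [arc]

theorem arc_split (f : ℕ → V) (i n k : ℕ) : arc f i (n+k) = arc f i n + arc f (i+n) k := by
  induction k with
  | zero => simp [arc_zero]
  | succ k ih => rw [← add_assoc, arc_succ, ih, arc_succ, add_assoc, add_assoc]

theorem arc_per {f : ℕ → V} (hp : ∀ i, f (i+m) = f i) (i : ℕ) : arc f i m = arc f 0 m := by
  induction i with
  | zero => rfl
  | succ i ih =>
    rw [← ih]
    have h1 := arc_succ f i m
    rw [arc_succ', hp, add_comm] at h1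
    exact add_right_cancel h1

theorem arc_walk {f : ℕ → V} (hr : ∀ i, Q (f i) (f (i+1))) (i n : ℕ) :
    W Q (f i) (f (i+n)) (arc f i (n+1)) := by
  induction n with
  | zero => rw [arc_one]; exact W.one _
  | succ n ih => rw [arc_succ]; exact ih.snoc (hr _)

/-- step-two sum -/
def two (f : ℕ → V) (s k : ℕ) : Multiset V := arc (fun j => f (s + 2*j)) 0 k

theorem two_shift {f : ℕ → V} {k : ℕ} (hp : ∀ i, f (i+2*k) = f i) (s : ℕ) :
    two f (s+2) k = two f s k := by
  have := arc_per (m := k) (f := fun j => f (s+2*j)) (by intro i; rw [← hp (s+2*i)]; congr 1; ring) 1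
  rw [two, two, ← this]
  simp only [arc]
  apply Finset.sum_congr rfl
  intro j _
  congr 2; ring

theorem two_even {f : ℕ → V} {k : ℕ} (hp : ∀ i, f (i+2*k) = f i) (s j : ℕ) :
    two f (s+2*j) k = two f s k := by
  induction j with
  | zero => rfl
  | succ j ih => rw [← ih, ← two_shift hp (s+2*j)]; rfl

theorem arc_two (f : ℕ → V) (s k : ℕ) : arc f s (2*k) = two f s k + two f (s+1) k := by
  induction k with
  | zero => simp [two, arc_zero]
  | succ k ih =>
    simp only [two] at *
    rw [show 2*(k+1) = 2*k+1+1 by ring, arc_succ, arc_succ, ih, arc_succ, arc_succ]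
    simp only [zero_add]
    rw [show s+1+2*k = s+(2*k+1) by ring]
    abel

theorem arc_odd {f : ℕ → V} {k : ℕ} (hp : ∀ i, f (i+(2*k+1)) = f i) (s : ℕ) :
    two f s (2*k+1) = arc f s (2*k+1) := by
  rw [arc_succ, arc_two, two, show 2*k+1 = k + (1+k) by ring, arc_split, arc_split, arc_one]
  simp only [two, zero_add]
  have : arc (fun j => f (s+2*j)) (k+1) k = arc (fun j => f (s+1+2*j)) 0 k := by
    simp only [arc]
    apply Finset.sum_congr rfl
    intro j _
    rw [← hp (s+1+2*(0+j))]; congr 2; ring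
  rw [this]; abel

theorem glue (hs : ∀ a b, Q a b → Q b a) (y : ℕ → V) (G : ℕ → Prop) (n : ℕ)
    (h1 : ∀ j, j < n → ¬ G j → Q (y j) (y (j+1)))
    (h2 : ∀ i j, i < j → j < n → G i → G j → Q (y i) (y j) ∧ Q (y (i+1)) (y (j+1))) :
    W Q (y 0) (y n) (arc y 0 (n+1)) ∨
    ∃ j, j < n ∧ G j ∧ ∃ A B, W Q (y 0) (y j) A ∧ W Q (y n) (y (j+1)) B ∧
      A + B = arc y 0 (n+1) := by
  induction n with
  | zero => left; rw [arc_one]; exact W.one _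
  | succ n ih =>
    specialize ih (fun j hj => h1 j (by omega)) (fun i j hij hj => h2 i j hij (by omega))
    rw [arc_succ, zero_add]
    by_cases hG : G n
    · rcases ih with ih | ⟨j, hj, hGj, A, B, hA, hB, e⟩
      · right
        exact ⟨n, by omega, hG, _, _, ih, W.one _, rfl⟩
      · left
        rw [← e]
        obtain ⟨q1, q2⟩ := h2 j n hj (by omega) hGj hG
        exact (hA.app q1 hB).snoc q2
    · have q := h1 n (by omega) hG
      rcases ih with ih | ⟨j, hj, hGj, A, B, hA, hB, e⟩
      · left; exact ih.snoc q
      · right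
        refine ⟨j, by omega, hGj, A, _, hA, W.cons (hs _ _ q) hB, ?_⟩
        rw [← e]; abel

theorem glue' (hs : ∀ a b, Q a b → Q b a) (y : ℕ → V) (G : ℕ → Prop) (n : ℕ)
    (h1 : ∀ j, j < n → ¬ G j → Q (y j) (y (j+1)))
    (h2 : ∀ i j, i < j → j ≤ n → G i → G j → Q (y i) (y j) ∧ Q (y (i+1)) (y (j+1)))
    (hn : G n) :
    ∃ z, W Q (y 0) z (arc y 0 (n+1)) ∧ (z = y n ∨ ∃ j, j < n ∧ G j ∧ z = y (j+1)) := by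
  rcases glue hs y G n h1 (fun i j hij hj => h2 i j hij (by omega)) with
    h | ⟨j, hj, hGj, A, B, hA, hB, e⟩
  · exact ⟨_, h, Or.inl rfl⟩
  · refine ⟨_, (hA.app (h2 j n hj le_rfl hGj hn).1 hB).cast e, Or.inr ⟨j, hj, hGj, rfl⟩⟩

structure Ctx (R : V → V → Prop) (U : Multiset V) (m : ℕ) : Prop where
  pos : 0 < m
  symm : ∀ a b, R a b → R b a
  nofin : ¬ Fine R U
  nomore : ∀ a b M₁ x y M₂, W R a b M₁ → R b a → m < Multiset.card M₁ →
    W (fun a b => ¬ R a b) x y M₂ → M₁ + M₂ ≠ U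

structure Cfg (R : V → V → Prop) (U : Multiset V) (m : ℕ) (f : ℕ → V) (x y : V)
    (M : Multiset V) : Prop where
  per : ∀ i, f (i + m) = f i
  red : ∀ i, R (f i) (f (i+1))
  w : W (fun a b => ¬ R a b) x y M
  tot : arc f 0 m + M = U

variable {f : ℕ → V} {x y : V} {M : Multiset V}

theorem Ctx.bs (C : Ctx R U m) : ∀ a b, ¬ R a b → ¬ R b a := fun a b h h' => h (C.symm _ _ h')

theorem Ctx.comm (C : Ctx R U m) (a b : V) : R a b ↔ R b a := ⟨C.symm _ _, C.symm _ _⟩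

theorem Cfg.flip (C : Ctx R U m) (F : Cfg R U m f x y M) : Cfg R U m f y x M :=
  ⟨F.per, F.red, F.w.rev C.bs, F.tot⟩

theorem Cfg.shift (F : Cfg R U m f x y M) (s : ℕ) : Cfg R U m (fun j => f (s + j)) x y M := by
  refine ⟨fun i => by rw [← add_assoc, F.per], fun i => F.red _, F.w, ?_⟩
  rw [← F.tot, ← arc_per F.per s]
  simp [arc]

theorem Cfg.permul (F : Cfg R U m f x y M) (i j : ℕ) : f (i + m * j) = f i := by
  induction j with
  | zero => rfl
  | succ j ih => rw [Nat.mul_succ, ← add_assoc, F.per, ih]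

theorem Cfg.tot' (F : Cfg R U m f x y M) (s : ℕ) : arc f s m + M = U := by
  rw [arc_per F.per, F.tot]

/-- the red arc from `s` of all vertices but -/
theorem Cfg.arcw (F : Cfg R U m f x y M) (i n : ℕ) : W R (f i) (f (i+n)) (arc f i (n+1)) :=
  arc_walk F.red i n

theorem Cfg.arcw' (F : Cfg R U m f x y M) (i n : ℕ) (hn : 0 < n) :
    W R (f i) (f (i+n-1)) (arc f i n) := by
  obtain ⟨n, rfl⟩ : ∃ k, n = k+1 := ⟨n-1, by omega⟩
  exact F.arcw i n

theorem Cfg.cyc (C : Ctx R U m) (F : Cfg R U m f x y M) : Cyc R (arc f 0 m) := by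
  right; right
  refine ⟨_, _, F.arcw' 0 m C.pos, ?_⟩
  have := F.red (0+m-1)
  rwa [show 0+m-1+1 = 0+m by have := C.pos; omega, F.per] at this

theorem Cfg.xy (C : Ctx R U m) (F : Cfg R U m f x y M) : R x y := by
  by_contra h
  exact C.nofin ⟨_, _, F.tot, F.cyc C, Or.inr (Or.inr ⟨x, y, F.w, C.bs _ _ h⟩)⟩

/-- decomposition of the blue path -/
theorem Cfg.dec (C : Ctx R U m) (F : Cfg R U m f x y M) :
    ∃ x₂ x₃ M₂, ¬ R x x₂ ∧ ¬ R x₂ x₃ ∧ W (fun a b => ¬ R a b) x₃ y M₂ ∧ M = {x} + ({x₂} + M₂) := by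
  have hw := F.w
  have hxy := F.xy C
  cases hw with
  | one => exact absurd ⟨_, _, F.tot, F.cyc C, Or.inr (Or.inl ⟨x, rfl⟩)⟩ C.nofin
  | cons h1 h =>
    cases h with
    | one => exact absurd hxy h1
    | cons h2 h3 => exact ⟨_, _, _, h1, h2, h3, rfl⟩

theorem W.dropLast {a b : V} {M : Multiset V} (h : W Q a b M) :
    (M = {b} ∧ a = b) ∨ ∃ c M', W Q a c M' ∧ Q c b ∧ M = M' + {b} := by
  induction h with
  | one a => left; exact ⟨rfl, rfl⟩
  | @cons a b c M h1 _ ih =>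
    right
    rcases ih with ⟨rfl, rfl⟩ | ⟨d, M', hw, hq, rfl⟩
    · exact ⟨a, {a}, W.one a, h1, rfl⟩
    · exact ⟨d, _, W.cons h1 hw, hq, by rw [add_assoc]⟩

/-- touching in red an end of the blue path -/
def T (R : V → V → Prop) (x y v : V) : Prop := R v x ∨ R v y

/-- a red path inserted -/
theorem Cfg.ext (C : Ctx R U m) (F : Cfg R U m f x y M) {u v : V} (hu : u = x ∨ u = y)
    (hv : v = x ∨ v = y) : ∃ Z Z', W R u v Z ∧ 0 < Multiset.card Z ∧ Z + Z' = M ∧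
      ∃ a b, W (fun a b => ¬ R a b) a b Z' := by
  have hxy := F.xy C
  obtain ⟨x₂, x₃, M₂, h1, h2, hw, rfl⟩ := F.dec C
  obtain ⟨y₂, y₃, N₂, k1, k2, kw, e⟩ := (F.flip C).dec C
  have key : ∃ Z', {x} + {y} + Z' = {x} + ({x₂} + M₂) ∧ ∃ a b, W (fun a b => ¬ R a b) a b Z' := by
    rcases hw.dropLast with ⟨rfl, rfl⟩ | ⟨c, M', hw', _, rfl⟩
    · exact ⟨{x₂}, by abel, _, _, W.one _⟩
    · exact ⟨{x₂} + M', by abel, _, _, W.cons h2 hw'⟩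
  obtain ⟨Z', eZ, hZ⟩ := key
  rcases hu with rfl | rfl <;> rcases hv with rfl | rfl
  · exact ⟨_, _, W.one _, by simp, rfl, _, _, W.cons h2 hw⟩
  · exact ⟨_, _, (W.one _).snoc hxy, by simp, eZ, hZ⟩
  · exact ⟨_, _, (W.one _).snoc (C.symm _ _ hxy), by simp, by rw [← eZ]; abel, hZ⟩
  · exact ⟨_, _, W.one _, by simp, e.symm, _, _, W.cons k2 kw⟩

theorem Cfg.hp (C : Ctx R U m) (F : Cfg R U m f x y M) {a b : V} {N : Multiset V}
    (h : W R a b N) (hN : N = arc f 0 m) (ha : T R x y a) (hb : T R x y b) : False := by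
  have aux : ∀ v, T R x y v → ∃ u, (u = x ∨ u = y) ∧ R v u := by
    rintro v (h | h)
    exacts [⟨x, Or.inl rfl, h⟩, ⟨y, Or.inr rfl, h⟩]
  obtain ⟨v, hv, hav⟩ := aux a ha
  obtain ⟨u, hu, hbu⟩ := aux b hb
  obtain ⟨Z, Z', hZ, hc, e, p, q, hp⟩ := F.ext C hu hv
  refine C.nomore _ _ _ _ _ _ (h.app hbu hZ) (C.symm _ _ hav) ?_ hp ?_
  · rw [Multiset.card_add, hN, arc_card]; omega
  · rw [hN, ← F.tot, ← e]; abel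

theorem Cfg.attach (C : Ctx R U m) (F : Cfg R U m f x y M) {a b : V} {N : Multiset V}
    (h : W (fun a b => ¬ R a b) a b N) (hN : N = arc f 0 m) (ha : ¬ T R x y a)
    (hb : ¬ T R x y b) : False := by
  simp only [T, not_or] at ha hb
  refine C.nofin ⟨0, N + M, by rw [hN, zero_add, F.tot], Or.inl rfl, Or.inr (Or.inr ?_)⟩
  exact ⟨_, _, h.app hb.1 F.w, C.bs _ _ ha.2⟩

theorem Cfg.T_succ (C : Ctx R U m) (F : Cfg R U m f x y M) (i : ℕ) (h : T R x y (f i)) :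
    ¬ T R x y (f (i+1)) := by
  intro h'
  have := F.arcw' (i+1) m C.pos
  rw [show i+1+m-1 = i+m by omega, F.per] at this
  exact F.hp C this (arc_per F.per _) h' h

theorem Cfg.T_cross (C : Ctx R U m) (F : Cfg R U m f x y M) (i n : ℕ) (hn : ¬ m ∣ n)
    (h : T R x y (f i)) (h' : T R x y (f (i+n))) : ¬ R (f (i+1)) (f (i+n+1)) := by
  have e1 : f (i+n) = f (i+n%m) := by
    conv_lhs => rw [← Nat.mod_add_div n m, ← add_assoc]
    exact F.permul _ _
  have e2 : f (i+n+1) = f (i+n%m+1) := by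
    conv_lhs => rw [← Nat.mod_add_div n m, ← add_assoc, add_right_comm]
    exact F.permul _ _
  rw [e1] at h'
  rw [e2]
  have hlt := Nat.mod_lt n C.pos
  have hpos : 0 < n % m := Nat.pos_of_ne_zero fun h => hn (Nat.dvd_of_mod_eq_zero h)
  generalize n % m = r at *
  intro hr
  have w1 := (F.arcw' (i+1) r hpos).rev C.symm
  have w2 := F.arcw' (i+r+1) (m-r) (by omega)
  rw [show i+1+r-1 = i+r by omega] at w1
  rw [show i+r+1+(m-r)-1 = i+m by omega, F.per] at w2
  refine F.hp C (w1.app hr w2) ?_ h' h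
  rw [← arc_per F.per (i+1), ← show r + (m-r) = m by omega, arc_split]
  rw [show r + (m-r) - r = m - r by omega, show i+1+r = i+r+1 by omega]

theorem Cfg.T_cross' (C : Ctx R U m) (F : Cfg R U m f x y M) (i n : ℕ) (hn : ¬ m ∣ n)
    (h : T R x y (f (i+1))) (h' : T R x y (f (i+n+1))) : ¬ R (f i) (f (i+n)) := by
  have e1 : f (i+n) = f (i+n%m) := by
    conv_lhs => rw [← Nat.mod_add_div n m, ← add_assoc]
    exact F.permul _ _
  have e2 : f (i+n+1) = f (i+n%m+1) := by
    conv_lhs => rw [← Nat.mod_add_div n m, ← add_assoc, add_right_comm]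
    exact F.permul _ _
  rw [e2] at h'
  rw [e1]
  have hlt := Nat.mod_lt n C.pos
  have hpos : 0 < n % m := Nat.pos_of_ne_zero fun h => hn (Nat.dvd_of_mod_eq_zero h)
  generalize n % m = r at *
  intro hr
  have w1 := F.arcw' (i+1) r hpos
  have w2 := (F.arcw' (i+r+1) (m-r) (by omega)).rev C.symm
  rw [show i+1+r-1 = i+r by omega] at w1
  rw [show i+r+1+(m-r)-1 = i+m by omega, F.per] at w2
  refine F.hp C (w1.app (C.symm _ _ hr) w2) ?_ h h'
  rw [← arc_per F.per (i+1), ← show r + (m-r) = m by omega, arc_split]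
  rw [show r + (m-r) - r = m - r by omega, show i+1+r = i+r+1 by omega]

theorem Cfg.small (C : Ctx R U m) (F : Cfg R U m f x y M) : 3 ≤ m := by
  by_contra hm
  have : ∃ i, ¬ T R x y (f i) := by
    by_contra h
    push Not at h
    exact F.T_succ C 0 (h 0) (h 1)
  obtain ⟨i, hi⟩ := this
  have hi' := hi
  simp only [T, not_or] at hi
  refine C.nofin ⟨arc f (i+1) (m-1), {f i} + M, ?_, ?_, Or.inr (Or.inr ?_)⟩
  · rw [← F.tot' i, ← show (m-1)+1 = m by have := C.pos; omega, arc_succ']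
    simp only [Nat.add_sub_cancel]
    abel
  · have := C.pos
    obtain rfl | rfl : m = 1 ∨ m = 2 := by omega
    · left; exact arc_zero _ _
    · right; left; exact ⟨_, arc_one _ _⟩
  · exact ⟨_, _, W.cons hi.1 F.w, C.bs _ _ hi.2⟩

theorem Cfg.skip (C : Ctx R U m) (F : Cfg R U m f x y M) (i : ℕ) (h : ¬ T R x y (f (i+1))) :
    ¬ R (f i) (f (i+2)) := by
  intro hr
  have := F.small C
  simp only [T, not_or] at h
  refine C.nofin ⟨arc f (i+2) (m-1), {f (i+1)} + M, ?_, Or.inr (Or.inr ?_), Or.inr (Or.inr ?_)⟩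
  · rw [← F.tot' (i+1), ← show (m-1)+1 = m by omega, arc_succ']
    simp only [Nat.add_sub_cancel]
    abel
  · refine ⟨_, _, F.arcw' (i+2) (m-1) (by omega), ?_⟩
    rwa [show i+2+(m-1)-1 = i+m by omega, F.per]
  · exact ⟨_, _, W.cons h.1 F.w, C.bs _ _ h.2⟩

theorem Cfg.Tper (F : Cfg R U m f x y M) (i j : ℕ) : T R x y (f (i+m*j)) ↔ T R x y (f i) := by
  rw [F.permul]

/-- blue path through every second vertex, starting right after a `T`-vertex -/
theorem Cfg.path2 (C : Ctx R U m) (F : Cfg R U m f x y M) (t n : ℕ)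
    (hn : ∀ i j, i < j → j ≤ n → ¬ m ∣ 2*(j-i)) (hm : m ∣ 2*(n+1)) (ht : T R x y (f t)) :
    ∃ z, W (fun a b => ¬ R a b) (f (t+1)) z (two f (t+1) (n+1)) ∧ ¬ T R x y z := by
  obtain ⟨c, hc⟩ := hm
  have hlast : T R x y (f (t+1+2*n+1)) := by
    rw [show t+1+2*n+1 = t + m*c by omega, F.permul]; exact ht
  obtain ⟨z, hz, hz'⟩ := glue' C.bs (fun j => f (t+1+2*j)) (fun j => T R x y (f (t+1+2*j+1))) n
    (fun j _ h => F.skip C _ h) (by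
      intro i j hij hj hi hj'
      have hd := hn i j hij hj
      constructor
      · have := F.T_cross' C (t+1+2*i) (2*(j-i)) hd hi (by
          rwa [show t+1+2*i+2*(j-i) = t+1+2*j by omega])
        rwa [show t+1+2*i+2*(j-i) = t+1+2*j by omega] at this
      · have := F.T_cross C (t+1+2*i+1) (2*(j-i)) hd hi (by
          rwa [show t+1+2*i+1+2*(j-i) = t+1+2*j+1 by omega])
        rwa [show t+1+2*i+1+2*(j-i)+1 = t+1+2*(j+1) by omega] at this) hlast
  refine ⟨z, hz, ?_⟩
  rcases hz' with rfl | ⟨j, hj, hT, rfl⟩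
  · intro h
    exact F.T_succ C _ h hlast
  · exact F.T_succ C _ hT

/-- blue path through every second vertex, no `T` in the gaps -/
theorem Cfg.path2' (C : Ctx R U m) (F : Cfg R U m f x y M) (s n : ℕ)
    (ht : ∀ j, ¬ T R x y (f (s + 1 + 2*j))) :
    W (fun a b => ¬ R a b) (f s) (f (s+2*n)) (two f s (n+1)) := by
  have := arc_walk (Q := fun a b => ¬ R a b) (f := fun j => f (s+2*j)) (by
    intro i
    refine F.skip C _ ?_
    have := ht i
    rwa [show s+1+2*i = s+2*i+1 by omega] at this) 0 n
  simpa [two] using this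

theorem Cfg.even (C : Ctx R U m) (F : Cfg R U m f x y M) : ∃ k, m = 2*k ∧ 2 ≤ k := by
  have h3 := F.small C
  rcases Nat.even_or_odd' m with ⟨k, rfl | rfl⟩
  · exact ⟨k, rfl, by omega⟩
  exfalso
  by_cases h : ∃ t, T R x y (f t)
  · obtain ⟨t, ht⟩ := h
    obtain ⟨z, hz, hz'⟩ := F.path2 C t (2*k) (by
      intro i j hij hj hd
      have hd' := (Nat.Coprime.dvd_of_dvd_mul_left (by simp) hd)
      have := Nat.le_of_dvd (by omega) hd'
      omega) ⟨2, by ring⟩ ht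
    exact F.attach C hz (by rw [arc_odd F.per, arc_per F.per]) (F.T_succ C _ ht) hz'
  · push Not at h
    exact F.attach C (F.path2' C 0 (2*k) (fun _ => h _)) (by rw [arc_odd F.per]) (h _) (h _)

theorem Cfg.classes (C : Ctx R U m) (F : Cfg R U m f x y M) :
    (∀ j, ¬ T R x y (f (2*j))) ∨ (∀ j, ¬ T R x y (f (2*j+1))) := by
  obtain ⟨k, rfl, hk⟩ := F.even C
  by_contra h
  push Not at h
  obtain ⟨⟨a, ha⟩, ⟨b, hb⟩⟩ := h
  -- move b beyond a
  have hb' : T R x y (f (2*a + (2*b+1 + 2*k*a - 2*a))) := by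
    rw [show 2*a + (2*b+1 + 2*k*a - 2*a) = (2*b+1) + 2*k*a by
      have : 2*a ≤ 2*k*a := by nlinarith
      omega, F.permul]
    exact hb
  have hka : 2*a ≤ 2*k*a := by nlinarith
  have hdv : ∀ i j, i < j → j ≤ k-1 → ¬ 2*k ∣ 2*(j-i) := by
    intro i j hij hj hd
    have := Nat.le_of_dvd (by omega) hd
    omega
  have hodd : ¬ 2*k ∣ (2*b+1 + 2*k*a - 2*a) := by
    intro hd
    have h2 : 2 ∣ (2*b+1 + 2*k*a - 2*a) := dvd_trans (dvd_mul_right _ _) hd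
    rw [mul_assoc] at h2
    have hka : 2*a ≤ 2*(k*a) := by nlinarith
    omega
  obtain ⟨z, hz, hz'⟩ := F.path2 C _ (k-1) hdv ⟨1, by omega⟩ ha
  obtain ⟨z2, hz2, hz2'⟩ := F.path2 C _ (k-1) hdv ⟨1, by omega⟩ hb'
  have hx := F.T_cross C _ _ hodd ha hb'
  refine F.attach C ((hz.rev C.bs).app hx hz2) ?_ hz' hz2'
  rw [show k-1+1 = k by omega, arc_two]
  rw [show 2*a + (2*b+1 + 2*k*a - 2*a) + 1 = 0 + 2*(b+1+k*a) by
    rw [mul_assoc] at *; omega, two_even F.per, show 2*a+1 = 0+1+2*a by omega,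
    two_even F.per, add_comm]

/-- replace the vertex at index `1` -/
def repl (m : ℕ) (f : ℕ → V) (v : V) (i : ℕ) : V := if i % m = 1 then v else f i

theorem Cfg.repl (C : Ctx R U m) (F : Cfg R U m f x y M) {v x' y' : V} {M' : Multiset V}
    (h0 : R (f 0) v) (h2 : R (f 2) v) (hw : W (fun a b => ¬ R a b) x' y' M')
    (e : {v} + M' = {f 1} + M) : Cfg R U m (repl m f v) x' y' M' := by
  have h3 := F.small C
  have hmod : ∀ i, f i = f (i % m) := fun i => by
    conv_lhs => rw [← Nat.mod_add_div i m]
    exact F.permul _ _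
  refine ⟨?_, ?_, hw, ?_⟩
  · intro i
    simp [Lehel.repl, F.per]
  · intro i
    simp only [Lehel.repl]
    have hlt := Nat.mod_lt i C.pos
    by_cases h1 : i % m = 1
    · have h2' : (i+1) % m = 2 := by
        rw [Nat.add_mod, h1, Nat.mod_eq_of_lt (by omega : 1 < m)]
        exact Nat.mod_eq_of_lt (by omega)
      rw [if_pos h1, if_neg (by omega), hmod, h2']
      exact C.symm _ _ h2
    · rw [if_neg h1]
      by_cases h2 : (i+1) % m = 1
      · rw [if_pos h2]
        have : i % m = 0 := by
          rw [Nat.add_mod, Nat.mod_eq_of_lt (by omega : 1 < m)] at h2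
          by_contra h
          by_cases h5 : i % m + 1 < m
          · rw [Nat.mod_eq_of_lt h5] at h2; omega
          · rw [show i % m + 1 = m by omega, Nat.mod_self] at h2; omega
        rw [hmod, this]; exact h0
      · rw [if_neg h2]; exact F.red i
  · obtain ⟨n, rfl⟩ : ∃ n, m = n+3 := ⟨m-3, by omega⟩
    have hs : arc (Lehel.repl (n+3) f v) 2 (n+1) = arc f 2 (n+1) := by
      simp only [arc]
      apply Finset.sum_congr rfl
      intro j hj
      rw [Finset.mem_range] at hj
      simp only [Lehel.repl]
      rw [if_neg (by rw [Nat.mod_eq_of_lt (by omega)]; omega)]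
    rw [← F.tot, arc_succ', arc_succ', zero_add, hs, arc_succ' f 0, arc_succ' f (0+1)]
    have e0 : Lehel.repl (n+3) f v 0 = f 0 := by simp [Lehel.repl]
    have e1 : Lehel.repl (n+3) f v 1 = v := by simp [Lehel.repl]
    rw [e0, e1]
    simp only [zero_add]
    calc _ = {f 0} + arc f 2 (n+1) + ({v} + M') := by abel
      _ = _ := by rw [e]; abel

theorem repl_ne {v : V} {i : ℕ} (h : i % m ≠ 1) : repl m f v i = f i := if_neg h

theorem Cfg.opath (C : Ctx R U m) (F : Cfg R U m f x y M) {k : ℕ} (hk : m = 2*k)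
    (hO : ∀ j, ¬ T R x y (f (2*j+1))) :
    ∃ a b, W (fun a b => ¬ R a b) a b (two f 1 k) ∧ ¬ T R x y a ∧ ¬ T R x y b ∧
      (T R x y (f 0) → a = f 1) := by
  have h3 := F.small C
  subst hk
  have hdv : ∀ i j, i < j → j ≤ k-1 → ¬ 2*k ∣ 2*(j-i) := by
    intro i j hij hj hd
    have := Nat.le_of_dvd (by omega) hd
    omega
  by_cases h0 : T R x y (f 0)
  · obtain ⟨z, hz, hz'⟩ := F.path2 C _ (k-1) hdv ⟨1, by omega⟩ h0
    rw [show k-1+1 = k by omega, zero_add] at hz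
    exact ⟨_, _, hz, hO 0, hz', fun _ => rfl⟩
  by_cases h : ∃ t, T R x y (f (2*t))
  · obtain ⟨t, ht⟩ := h
    obtain ⟨z, hz, hz'⟩ := F.path2 C _ (k-1) hdv ⟨1, by omega⟩ ht
    rw [show k-1+1 = k by omega, show 2*t+1 = 1 + 2*t by omega, two_even F.per] at hz
    exact ⟨_, _, hz, by rw [add_comm]; exact hO t, hz', fun h => absurd h h0⟩
  · push Not at h
    have := F.path2' C 1 (k-1) (fun j => by
      have := h (j+1)
      rwa [show 1+1+2*j = 2*(j+1) by ring])
    rw [show k-1+1 = k by omega] at this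
    refine ⟨_, _, this, hO 0, ?_, fun h => absurd h h0⟩
    rw [add_comm]; exact hO _

theorem Cfg.epath (C : Ctx R U m) (F : Cfg R U m f x y M) {k : ℕ} (hk : m = 2*k)
    (hO : ∀ j, ¬ T R x y (f (2*j+1))) (j : ℕ) :
    W (fun a b => ¬ R a b) (f (2*j+2)) (f (2*j)) (two f 0 k) := by
  have h3 := F.small C
  subst hk
  have := F.path2' C (2*j+2) (k-1) (fun i => by
      have := hO (j+1+i)
      rwa [show 2*j+2+1+2*i = 2*(j+1+i)+1 by ring])
  rw [show k-1+1 = k by omega, show 2*j+2 = 0+2*(j+1) by ring, two_even F.per,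
    show 0+2*(j+1)+2*(k-1) = 2*j + 2*k by omega, F.per, show 0+2*(j+1) = 2*j+2 by ring] at this
  exact this

theorem Cfg.propR (C : Ctx R U m) (F : Cfg R U m f x y M)
    (hO : ∀ j, ¬ T R x y (f (2*j+1))) {a b : V} {k : ℕ} (hk : m = 2*k)
    (hE : W (fun a b => ¬ R a b) a b (two f 0 k)) (ha : ¬ T R x y a) {x₂ : V} {M' : Multiset V}
    (hw : W (fun a b => ¬ R a b) x₂ y M') (hM : M = {x} + M') : R b x₂ := by
  by_contra hb
  obtain ⟨p, q, hp, hpT, hqT, -⟩ := F.opath C hk hO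
  simp only [T, not_or] at ha hpT hqT
  refine C.nofin ⟨0, U, zero_add _, Or.inl rfl, Or.inr (Or.inr ⟨x, q, ?_, hqT.1⟩)⟩
  refine (W.cons (C.bs _ _ ha.1) ((hE.app hb hw).app (C.bs _ _ hpT.2) hp)).cast ?_
  rw [← F.tot, hM, hk, arc_two]
  simp only [zero_add]
  abel

theorem Cfg.propT (C : Ctx R U m) (F : Cfg R U m f x y M)
    (hO : ∀ j, ¬ T R x y (f (2*j+1))) (h0 : T R x y (f 0)) (h2 : ¬ T R x y (f 2))
    {x₂ : V} {M' : Multiset V}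
    (hw : W (fun a b => ¬ R a b) x₂ y M') (hM : M = {x} + M') : R (f 2) x₂ := by
  by_contra hb
  obtain ⟨k, hk, hk2⟩ := F.even C
  obtain ⟨p, q, hp, hpT, hqT, hst⟩ := F.opath C hk hO
  obtain rfl := hst h0
  have h41 : R (f 1) (f 4) := by
    by_contra h
    have hE := (F.epath C hk hO 1).rev C.bs
    refine F.attach C (hE.app (C.bs _ _ h) hp) ?_ h2 hqT
    rw [hk, arc_two]
  have h3T := hO 1
  simp only [T, not_or] at h2 h3T
  refine C.nofin ⟨arc f 4 (m-2), {x} + ({f 2} + (M' + {f 3})), ?_, Or.inr (Or.inr ?_),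
    Or.inr (Or.inr ?_)⟩
  · rw [← F.tot' 2, hM]
    obtain ⟨n, rfl⟩ : ∃ n, m = n + 2 := ⟨m-2, by omega⟩
    rw [arc_succ', arc_succ']
    simp only [Nat.add_sub_cancel]
    abel
  · refine ⟨_, _, F.arcw' 4 (m-2) (by omega), ?_⟩
    rwa [show 4+(m-2)-1 = 1+m by omega, F.per]
  · exact ⟨_, _, W.cons (C.bs _ _ h2.1) (W.cons hb (hw.snoc (C.bs _ _ h3T.2))), h3T.1⟩

theorem Cfg.main (C : Ctx R U m) (F : Cfg R U m f x y M)
    (hO : ∀ j, ¬ T R x y (f (2*j+1))) (h2 : ¬ T R x y (f 2))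
    {x₂ x₃ : V} {M₂ : Multiset V}
    (hw : W (fun a b => ¬ R a b) x₃ y M₂) (hM : M = {x} + ({x₂} + M₂))
    (q0 : R (f 0) x₂) (q2 : R (f 2) x₂) (q4 : R (f 4) x₂) :
    ¬ R (f 0) x ∧ ¬ R (f 2) x₃ := by
  obtain ⟨k, hk, hk2⟩ := F.even C
  have hO0 := hO 0
  have hO1 := hO 1
  simp only [T, not_or, mul_zero, zero_add, mul_one, Nat.reduceAdd] at hO0 hO1
  have F' := F.repl C q0 q2 ((hw.snoc (C.bs _ _ hO0.2)).snoc hO0.1) (by rw [hM]; abel)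
  rcases F'.classes C with h | h
  · have e0 := h 0
    have e2 := h 1
    rw [repl_ne (by simp)] at e0
    rw [repl_ne (by rw [Nat.mod_eq_of_lt (by omega)]; omega)] at e2
    simp only [T, not_or] at e0 e2
    exact ⟨e0.2, e2.1⟩
  · exfalso
    have e3 := h 1
    rw [repl_ne (by rw [Nat.mod_eq_of_lt (by omega)]; omega)] at e3
    have hs := F.skip C 1 h2
    simp only [T, not_or] at e3 h2
    refine C.nofin ⟨{x₂} + arc f 4 (m-3), M₂ + ({f 2} + ({x} + ({f 1} + {f 3}))), ?_,
      Or.inr (Or.inr ⟨x₂, f 0, ?_, q0⟩), Or.inr (Or.inr ⟨x₃, f 3, ?_, e3.1⟩)⟩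
    · rw [← F.tot' 1, hM]
      obtain ⟨n, rfl⟩ : ∃ n, m = n + 3 := ⟨m-3, by omega⟩
      rw [arc_succ', arc_succ', arc_succ']
      simp only [Nat.add_sub_cancel]
      abel
    · refine W.cons (C.symm _ _ q4) ((F.arcw' 4 (m-3) (by omega)).cast3 rfl ?_ rfl)
      rw [show 4+(m-3)-1 = 0+m by omega, F.per]
    · exact hw.app (C.bs _ _ h2.2) (W.cons h2.1 (W.cons (C.bs _ _ hO0.1) (W.cons hs (W.one _))))

theorem Cfg.mixed (C : Ctx R U m) (F : Cfg R U m f x y M)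
    (hO : ∀ j, ¬ T R x y (f (2*j+1))) (h0 : T R x y (f 0)) (h2 : ¬ T R x y (f 2)) :
    ¬ R (f 0) x := by
  obtain ⟨k, hk, hk2⟩ := F.even C
  obtain ⟨x₂, x₃, M₂, q1, q2, hw, hM⟩ := F.dec C
  have hw' := W.cons q2 hw
  have r0 := F.propR C hO hk (F.epath C hk hO 0) h2 hw' hM
  have r4 := F.propR C hO hk ((F.epath C hk hO 1).rev C.bs) h2 hw' hM
  exact (F.main C hO h2 hw hM r0 (F.propT C hO h0 h2 hw' hM) r4).1

theorem T_swap (x y v : V) : T R x y v ↔ T R y x v := or_comm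

theorem Cfg.mixed' (C : Ctx R U m) (F : Cfg R U m f x y M)
    (hO : ∀ j, ¬ T R x y (f (2*j+1))) (h0 : T R x y (f 0)) (h2 : ¬ T R x y (f 2)) : False := by
  rcases id h0 with h | h
  · exact F.mixed C hO h0 h2 h
  · refine (F.flip C).mixed C (fun j => ?_) ((T_swap ..).1 h0) ?_ h
    · rw [T_swap]; exact hO j
    · rw [T_swap]; exact h2

theorem Cfg.noT (C : Ctx R U m) (F : Cfg R U m f x y M) (h : ∀ j, ¬ T R x y (f j)) : False := by
  obtain ⟨k, hk, hk2⟩ := F.even C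
  obtain ⟨x₂, x₃, M₂, q1, q2, hw, hM⟩ := F.dec C
  have hw' := W.cons q2 hw
  have hE : ∀ j, R (f (2*j)) x₂ := fun j =>
    F.propR C (fun _ => h _) hk (F.epath C hk (fun _ => h _) j) (h _) hw' hM
  have hO : ∀ j, R (f (2*j+1)) x₂ := fun j => by
    have := (F.shift 1).propR C (fun _ => h _) hk
      ((F.shift 1).epath C hk (fun _ => h _) j) (h _) hw' hM
    rwa [add_comm 1] at this
  have h23 := (F.main C (fun _ => h _) (h 2) hw hM (hE 0) (hE 1) (hE 2)).2
  have s := F.skip C 0 (h 1)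
  have n0 := h 0
  have n1 := h 1
  simp only [T, not_or] at n0 n1
  refine C.nofin ⟨{x₂} + arc f 3 (m-3), M₂ + ({f 1} + ({x} + ({f 0} + {f 2}))), ?_,
      Or.inr (Or.inr ⟨x₂, f (2*(k-1)+1), ?_, hO _⟩), Or.inr (Or.inr ⟨x₃, f 2, ?_, h23⟩)⟩
  · rw [← F.tot' 0, hM]
    obtain ⟨n, rfl⟩ : ∃ n, m = n + 3 := ⟨m-3, by omega⟩
    rw [arc_succ', arc_succ', arc_succ']
    simp only [Nat.add_sub_cancel]
    abel
  · refine W.cons (C.symm _ _ (hO 1)) ((F.arcw' 3 (m-3) (by omega)).cast3 rfl ?_ rfl)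
    congr 1; omega
  · exact hw.app (C.bs _ _ n1.2) (W.cons n1.1 (W.cons (C.bs _ _ n0.1) (W.cons s (W.one _))))

theorem Cfg.pure (C : Ctx R U m) (F : Cfg R U m f x y M)
    {x₂ : V} {M' : Multiset V}
    (hw : W (fun a b => ¬ R a b) x₂ y M') (hM : M = {x} + M')
    (h1 : ¬ T R x y (f 1)) (h0 : R (f 0) x) (h2 : R (f 2) x) :
    R (f 1) x₂ ∧ ¬ R (f 3) x₂ ∧ ¬ R (f (m-1)) x₂ := by
  obtain ⟨k, hk, hk2⟩ := F.even C
  simp only [T, not_or] at h1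
  have F' := F.repl C h0 h2 (hw.snoc (C.bs _ _ h1.2)) (by rw [hM]; abel)
  refine ⟨C.symm _ _ (F'.xy C), ?_⟩
  rcases F'.classes C with h | h
  · exfalso
    apply h 1
    rw [repl_ne (by rw [Nat.mod_eq_of_lt (by omega)]; omega)]
    exact Or.inr (C.symm _ _ (F.red 1))
  · have e3 := h 1
    have em := h (k-1)
    rw [repl_ne (by rw [Nat.mod_eq_of_lt (by omega)]; omega)] at e3 em
    rw [show 2*(k-1)+1 = m-1 by omega] at em
    simp only [T, not_or] at e3 em
    exact ⟨e3.1, em.1⟩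

theorem Cfg.mix (C : Ctx R U m) (F : Cfg R U m f x y M)
    {x₂ : V} {M' : Multiset V}
    (hw : W (fun a b => ¬ R a b) x₂ y M') (hM : M = {x} + M')
    (h : (R (f 0) x ∧ R (f 2) y) ∨ (R (f 0) y ∧ R (f 2) x)) : R (f 1) x₂ := by
  by_contra hb
  have h3 := F.small C
  have hxy := F.xy C
  have key : ∀ u v, R (f 0) u → R u v → R (f 2) v → {u} + {v} = ({x} : Multiset V) + {y} → False := by
    intro u v hu huv hv e
    have w1 : W R (f 2) (f 0) (arc f 2 (m-1)) := (F.arcw' 2 (m-1) (by omega)).cast3 rfl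
      (by rw [show 2+(m-1)-1 = 0+m by omega, F.per]) rfl
    have w2 := (w1.snoc hu).snoc huv
    have tot : {f 1} + arc f 2 (m-1) = arc f 1 m := by
      rw [← arc_succ', show m-1+1 = m by omega]
    rcases hw.dropLast with ⟨rfl, rfl⟩ | ⟨c, N, hN, _, rfl⟩
    · refine C.nomore _ _ _ _ _ _ w2 (C.symm _ _ hv) (by simp [arc_card]; omega) (W.one (f 1)) ?_
      rw [← F.tot' 1, hM, ← tot, ← e]; abel
    · refine C.nomore _ _ _ _ _ _ w2 (C.symm _ _ hv) (by simp [arc_card]; omega)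
        (W.cons hb hN) ?_
      rw [← F.tot' 1, hM, ← tot]
      calc _ = {f 1} + arc f 2 (m-1) + N + ({u} + {v}) := by abel
        _ = _ := by rw [e]; abel
  rcases h with ⟨h0, h2⟩ | ⟨h0, h2⟩
  · exact key x y h0 hxy h2 rfl
  · exact key y x h0 (C.symm _ _ hxy) h2 (add_comm _ _)

theorem Cfg.mixmix (C : Ctx R U m) (F : Cfg R U m f x y M)
    {x₂ x₃ : V} {M₂ : Multiset V}
    (hw : W (fun a b => ¬ R a b) x₃ y M₂) (hM : M = {x} + ({x₂} + M₂))
    (h1 : R (f 1) x₂) (h3 : R (f 3) x₂) (h2 : R (f 2) x) (h4 : R (f 4) y) : False := by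
  obtain ⟨k, hk, hk2⟩ := F.even C
  have hxy := F.xy C
  have w1 : W R (f 0) (f 4) (arc f 4 (m-3)) := ((F.arcw' 4 (m-3) (by omega)).cast3 rfl
      (by rw [show 4+(m-3)-1 = 0+m by omega, F.per]) rfl).rev C.symm
  have w2 := W.cons (C.symm _ _ h2) (W.cons (F.red 2) (W.cons h3 (W.cons (C.symm _ _ h1)
    (W.cons (C.symm _ _ (F.red 0)) (w1.snoc h4)))))
  have tot : {f 1} + ({f 2} + ({f 3} + arc f 4 (m-3))) = arc f 1 m := by
    conv_rhs => rw [show m = m-3+1+1+1 by omega]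
    rw [arc_succ', arc_succ', arc_succ']
  rcases hw.dropLast with ⟨rfl, rfl⟩ | ⟨c, N, hN, _, rfl⟩
  · refine C.nofin ⟨_, 0, ?_, Or.inr (Or.inr ⟨_, _, w2, C.symm _ _ hxy⟩), Or.inl rfl⟩
    rw [← F.tot' 1, hM, ← tot]; abel
  · refine C.nomore _ _ _ _ _ _ w2 (C.symm _ _ hxy) (by simp [arc_card]; omega) hN ?_
    rw [← F.tot' 1, hM, ← tot]; abel

theorem Cfg.allT (C : Ctx R U m) (F : Cfg R U m f x y M)
    (n1 : ¬ T R x y (f 1)) (n3 : ¬ T R x y (f 3))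
    (t0 : T R x y (f 0)) (t2 : R (f 2) x) (t4 : T R x y (f 4)) : False := by
  obtain ⟨x₂, x₃, M₂, q1, q2, hw, hM⟩ := F.dec C
  have hw' := W.cons q2 hw
  have h3 := F.small C
  have em : f (2 + (m-1)) = f 1 := by rw [show 2+(m-1) = 1+m by omega, F.per]
  have P1 := F.pure C hw' hM n1
  have P3 := (F.shift 2).pure C hw' hM n3
  simp only [em] at P3
  rcases t0 with t0 | t0 <;> rcases t4 with t4 | t4
  · exact (P3 t2 t4).2.2 (P1 t0 t2).1
  · exact (P1 t0 t2).2.1 ((F.shift 2).mix C hw' hM (Or.inl ⟨t2, t4⟩))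
  · exact (P3 t2 t4).2.2 (F.mix C hw' hM (Or.inr ⟨t0, t2⟩))
  · exact F.mixmix C hw hM (F.mix C hw' hM (Or.inr ⟨t0, t2⟩))
      ((F.shift 2).mix C hw' hM (Or.inl ⟨t2, t4⟩)) t2 t4

theorem Cfg.contra0 (C : Ctx R U m) (F : Cfg R U m f x y M)
    (hO : ∀ j, ¬ T R x y (f (2*j+1))) : False := by
  by_cases h : ∃ a, T R x y (f (2*a))
  · obtain ⟨a, h0⟩ := h
    have hs : ∀ b j, ¬ T R x y (f (2*b + (2*j+1))) := fun b j => by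
      have := hO (b+j)
      rwa [show 2*(b+j)+1 = 2*b+(2*j+1) by ring] at this
    by_cases h2 : T R x y (f (2*a+2))
    · by_cases h4 : T R x y (f (2*a+4))
      · rcases h2 with h2 | h2
        · exact (F.shift (2*a)).allT C (hs a 0) (hs a 1) h0 h2 h4
        · refine ((F.shift (2*a)).flip C).allT C ?_ ?_ ((T_swap ..).1 h0) h2 ((T_swap ..).1 h4)
          · rw [T_swap]; exact hs a 0
          · rw [T_swap]; exact hs a 1
      · exact (F.shift (2*(a+1))).mixed' C (hs _) h2 h4
    · exact (F.shift (2*a)).mixed' C (hs _) h0 h2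
  · push Not at h
    refine F.noT C fun j => ?_
    rcases Nat.even_or_odd' j with ⟨k, rfl | rfl⟩
    exacts [h k, hO k]

theorem Cfg.contra (C : Ctx R U m) (F : Cfg R U m f x y M) : False := by
  rcases F.classes C with h | h
  · refine (F.shift 1).contra0 C fun j => ?_
    have := h (j+1)
    rwa [show 2*(j+1) = 1 + (2*j+1) by ring] at this
  · exact F.contra0 C h

theorem W.toFun {a b : V} {M : Multiset V} (h : W Q a b M) :
    ∃ (n : ℕ) (g : ℕ → V), g 0 = a ∧ g n = b ∧ (∀ i, i < n → Q (g i) (g (i+1))) ∧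
      arc g 0 (n+1) = M := by
  induction h with
  | one a => exact ⟨0, fun _ => a, rfl, rfl, fun i hi => by omega, arc_one _ _⟩
  | @cons a b c M h1 _ ih =>
    obtain ⟨n, g, g0, gn, gr, gM⟩ := ih
    refine ⟨n+1, fun i => Nat.casesOn i a g, rfl, gn, ?_, ?_⟩
    · rintro (_ | i) hi
      · simpa [g0] using h1
      · exact gr i (by omega)
    · rw [arc_succ', ← gM]
      congr 1
      simp only [arc]
      apply Finset.sum_congr rfl
      intro j _
      rw [show 0+1+j = j+1 by omega]
      simp

theorem mkCfg {a b x y : V} {M₁ M₂ : Multiset V} (h : W R a b M₁) (hc : R b a)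
    (hw : W (fun a b => ¬ R a b) x y M₂) (e : M₁ + M₂ = U) :
    0 < Multiset.card M₁ ∧ ∃ f, Cfg R U (Multiset.card M₁) f x y M₂ := by
  obtain ⟨n, g, g0, gn, gr, rfl⟩ := h.toFun
  rw [arc_card]
  refine ⟨by omega, fun i => g (i % (n+1)), ⟨?_, ?_, hw, ?_⟩⟩
  · intro i; simp
  · intro i
    have hlt : i % (n+1) < n+1 := Nat.mod_lt i (Nat.succ_pos n)
    by_cases h : i % (n+1) = n
    · have : (i+1) % (n+1) = 0 := by
        rw [Nat.add_mod, h]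
        rcases n with _ | n
        · simp [Nat.mod_one]
        · rw [Nat.mod_eq_of_lt (by omega : 1 < n+1+1), Nat.mod_self]
      simp only [h, this, g0, gn]; exact hc
    · have : (i+1) % (n+1) = i % (n+1) + 1 := by
        rw [Nat.add_mod, Nat.mod_eq_of_lt (by omega : 1 < n+1)]
        exact Nat.mod_eq_of_lt (by omega)
      simp only [this]
      exact gr _ (by omega)
  · rw [← e]
    congr 1
    simp only [arc]
    apply Finset.sum_congr rfl
    intro j hj
    rw [Finset.mem_range] at hj
    rw [Nat.mod_eq_of_lt (by omega)]

theorem fine_of_closed (hs : ∀ a b, R a b → R b a) {a b x y : V} {M₁ M₂ : Multiset V}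
    (h : W R a b M₁) (hc : R b a)
    (hw : W (fun a b => ¬ R a b) x y M₂) (e : M₁ + M₂ = U) : Fine R U := by
  classical
  by_contra hF
  let P : ℕ → Prop := fun m => ∃ a b M₁ x y M₂, W R a b M₁ ∧ R b a ∧ Multiset.card M₁ = m ∧
    W (fun a b => ¬ R a b) x y M₂ ∧ M₁ + M₂ = U
  have hb : ∀ m, P m → m ≤ Multiset.card U := by
    rintro m ⟨a, b, M₁, x, y, M₂, -, -, rfl, -, rfl⟩
    simp
  have h0 : P (Multiset.card M₁) := ⟨a, b, M₁, x, y, M₂, h, hc, rfl, hw, e⟩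
  have hg := Nat.findGreatest_spec (P := P) (hb _ h0) h0
  set m := Nat.findGreatest P (Multiset.card U) with hm
  obtain ⟨a, b, M₁, x, y, M₂, h, hc, ec, hw, e⟩ := hg
  obtain ⟨hpos, f, F⟩ := mkCfg h hc hw e
  rw [ec] at hpos F
  refine F.contra ⟨hpos, hs, hF, ?_⟩
  intro a b M₁ x y M₂ h hc hlt hw e
  have h1 : P (Multiset.card M₁) := ⟨a, b, M₁, x, y, M₂, h, hc, rfl, hw, e⟩
  have := Nat.le_findGreatest (P := P) (hb _ h1) h1
  omega

theorem W.tail {a b : V} {M : Multiset V} (h : W Q a b M) :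
    (M = {a} ∧ a = b) ∨ ∃ c M', Q a c ∧ W Q c b M' ∧ M = {a} + M' := by
  cases h with
  | one => left; exact ⟨rfl, rfl⟩
  | cons h1 h2 => right; exact ⟨_, _, h1, h2, rfl⟩

theorem W.head {a b : V} {M : Multiset V} (h : W Q a b M) : ∃ M', M = {a} + M' := by
  cases h with
  | one => exact ⟨0, rfl⟩
  | cons h1 h2 => exact ⟨_, rfl⟩

def Start (Q₁ Q₂ : V → V → Prop) (U : Multiset V) : Prop :=
  ∃ M₁ M₂, M₁ + M₂ = U ∧ Cyc Q₁ M₁ ∧ (M₂ = 0 ∨ ∃ x y, W Q₂ x y M₂)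

theorem fine_of_start (hs : ∀ a b, R a b → R b a) (h : Start R (fun a b => ¬ R a b) U) :
    Fine R U := by
  have bs : ∀ a b, ¬ R a b → ¬ R b a := fun a b h h' => h (hs _ _ h')
  obtain ⟨M₁, M₂, e, hc, rfl | ⟨x, y, hw⟩⟩ := h
  · exact ⟨_, _, e, hc, Or.inl rfl⟩
  rcases hc with rfl | ⟨c, rfl⟩ | ⟨a, b, h, hc⟩
  · by_cases hxy : R y x
    · rcases hw.tail with ⟨rfl, rfl⟩ | ⟨x₂, M', q, hw', rfl⟩
      · exact ⟨_, _, e, Or.inl rfl, Or.inr (Or.inl ⟨_, rfl⟩)⟩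
      · have w2 := (W.one x).snoc (hs _ _ hxy)
        rcases hw'.dropLast with ⟨rfl, rfl⟩ | ⟨z, N, hN, _, rfl⟩
        · exact ⟨_, 0, by rw [← e]; abel, Or.inr (Or.inr ⟨_, _, w2, hxy⟩), Or.inl rfl⟩
        · exact fine_of_closed hs w2 hxy hN (by rw [← e]; abel)
    · exact ⟨_, _, e, Or.inl rfl, Or.inr (Or.inr ⟨_, _, hw, hxy⟩)⟩
  · have key : ∀ x y, W (fun a b => ¬ R a b) x y M₂ → R c x → Fine R U := by
      intro x y hw hcx
      have w2 := (W.one c).snoc hcx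
      rcases hw.tail with ⟨rfl, rfl⟩ | ⟨x₂, M', q, hw', rfl⟩
      · exact ⟨_, 0, by rw [← e]; abel, Or.inr (Or.inr ⟨_, _, w2, hs _ _ hcx⟩), Or.inl rfl⟩
      · exact fine_of_closed hs w2 (hs _ _ hcx) hw' (by rw [← e]; abel)
    by_cases hx : R c x
    · exact key x y hw hx
    by_cases hy : R c y
    · exact key y x (hw.rev bs) hy
    · exact ⟨0, _, zero_add _, Or.inl rfl, Or.inr (Or.inr ⟨_, _,
        (W.cons hx hw).cast e, bs _ _ hy⟩)⟩
  · exact fine_of_closed hs h hc hw e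

def St (Q₁ Q₂ : V → V → Prop) (U : Multiset V) : Prop :=
  ∃ a z w A B, W Q₁ a z ({a} + A) ∧ W Q₂ a w ({a} + B) ∧ {a} + A + B = U

theorem St.swap {Q₁ Q₂ : V → V → Prop} (h : St Q₁ Q₂ U) : St Q₂ Q₁ U := by
  obtain ⟨a, z, w, A, B, h1, h2, e⟩ := h
  exact ⟨a, w, z, B, A, h2, h1, by rw [← e]; abel⟩

theorem st_step {Q₁ Q₂ : V → V → Prop} (s1 : ∀ a b, Q₁ a b → Q₁ b a)
    (hq : ∀ a b, Q₁ a b ∨ Q₂ a b) {a z w v : V} {A B : Multiset V}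
    (h1 : W Q₁ a z ({a} + A)) (h2 : W Q₂ a w ({a} + B)) (hv : Q₁ v a) :
    St Q₁ Q₂ ({v} + ({a} + A + B)) := by
  rcases h2.tail with ⟨e, rfl⟩ | ⟨b, B', q, hb, e⟩
  · obtain rfl : B = 0 := add_left_cancel (e.trans (add_zero _).symm)
    exact ⟨v, z, v, _, 0, W.cons hv h1, W.one v, by abel⟩
  · obtain rfl := add_left_cancel e
    rcases hq v b with h | h
    · obtain ⟨B', rfl⟩ := hb.head
      exact ⟨b, z, w, _, _, W.cons (s1 _ _ h) (W.cons hv h1), hb, by abel⟩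
    · exact ⟨v, z, w, _, _, W.cons hv h1, W.cons h hb, by abel⟩

theorem st_all {Q₁ Q₂ : V → V → Prop} (s1 : ∀ a b, Q₁ a b → Q₁ b a)
    (s2 : ∀ a b, Q₂ a b → Q₂ b a)
    (hq : ∀ a b, Q₁ a b ∨ Q₂ a b) (U : Multiset V) : U = 0 ∨ St Q₁ Q₂ U := by
  induction U using Multiset.induction with
  | empty => left; rfl
  | cons v U ih =>
    right
    rw [← Multiset.singleton_add]
    rcases ih with rfl | ⟨a, z, w, A, B, h1, h2, rfl⟩
    · exact ⟨v, v, v, 0, 0, W.one v, W.one v, by abel⟩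
    · rcases hq v a with h | h
      · exact st_step s1 hq h1 h2 h
      · have := (st_step s2 (fun a b => (hq a b).symm) h2 h1 h).swap
        rwa [add_right_comm {a} B A] at this

theorem start_of {Q₁ Q₂ : V → V → Prop}
    (s2 : ∀ a b, Q₂ a b → Q₂ b a)
    (hq : ∀ a b, Q₁ a b ∨ Q₂ a b) {a z w : V} {A B : Multiset V}
    (h1 : W Q₁ a z ({a} + A)) (h2 : W Q₂ a w ({a} + B)) (hv : Q₁ z w) :
    Start Q₁ Q₂ ({a} + A + B) ∨ Start Q₂ Q₁ ({a} + A + B) := by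
  rcases h2.tail with ⟨e, rfl⟩ | ⟨b, B', q, hb, e⟩
  · obtain rfl : B = 0 := add_left_cancel (e.trans (add_zero _).symm)
    exact Or.inr ⟨0, _, by abel, Or.inl rfl, Or.inr ⟨_, _, h1⟩⟩
  · obtain rfl := add_left_cancel e
    rcases hq w a with h | h
    · left
      rcases hb.dropLast with ⟨rfl, rfl⟩ | ⟨c, N, hN, _, rfl⟩
      · exact ⟨_, 0, by abel, Or.inr (Or.inr ⟨_, _, h1.snoc hv, h⟩), Or.inl rfl⟩
      · exact ⟨_, N, by abel, Or.inr (Or.inr ⟨_, _, h1.snoc hv, h⟩), Or.inr ⟨_, _, hN⟩⟩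
    · right
      refine ⟨_, A, by abel, Or.inr (Or.inr ⟨_, _, h2, h⟩), ?_⟩
      rcases h1.tail with ⟨e, rfl⟩ | ⟨c, A', q, hc, e⟩
      · left; exact add_left_cancel (e.trans (add_zero _).symm)
      · obtain rfl := add_left_cancel e
        exact Or.inr ⟨_, _, hc⟩

theorem lehel (hs : ∀ a b, R a b → R b a) (U : Multiset V) : Fine R U := by
  have bs : ∀ a b, ¬ R a b → ¬ R b a := fun a b h h' => h (hs _ _ h')
  have hq : ∀ a b, R a b ∨ ¬ R a b := fun a b => em _
  rcases st_all (Q₁ := R) (Q₂ := fun a b => ¬ R a b) hs bs hq U with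
    rfl | ⟨a, z, w, A, B, h1, h2, rfl⟩
  · exact ⟨0, 0, rfl, Or.inl rfl, Or.inl rfl⟩
  have : Start R (fun a b => ¬ R a b) ({a} + A + B) ∨ Start (fun a b => ¬ R a b) R ({a} + A + B) := by
    rcases hq z w with h | h
    · exact start_of bs hq h1 h2 h
    · have := start_of hs (fun a b => (hq a b).symm) h2 h1 (bs _ _ h)
      rw [add_right_comm {a} B A] at this
      exact this.symm
  rcases this with h | h
  · exact fine_of_start hs h
  · have h' : Start (fun a b => ¬ R a b) (fun a b => ¬ ¬ R a b) ({a} + A + B) := by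
      simpa only [not_not] using h
    obtain ⟨M₁, M₂, e, c1, c2⟩ := fine_of_start (R := fun a b => ¬ R a b) bs h'
    simp only [not_not] at c2
    exact ⟨M₂, M₁, by rw [← e, add_comm], c2, c1⟩

/-! conversion -/

theorem W.start_mem {a b : V} {M : Multiset V} (h : W Q a b M) : a ∈ M := by
  obtain ⟨M', rfl⟩ := h.head; simp

theorem W.toWalk (hs : ∀ a b, Q a b → Q b a) {a b : V} {M : Multiset V} (h : W Q a b M)
    (hn : M.Nodup) : ∃ p : (⊤ : SimpleGraph V).Walk a b, (p.support : Multiset V) = M ∧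
      ∀ x y, s(x, y) ∈ p.edges → Q x y := by
  induction h with
  | one a => exact ⟨SimpleGraph.Walk.nil, by simp, by simp⟩
  | @cons a b c M h1 h2 ih =>
    rw [Multiset.singleton_add, Multiset.nodup_cons] at hn
    obtain ⟨p, hp, he⟩ := ih hn.2
    have hab : a ≠ b := by rintro rfl; exact hn.1 h2.start_mem
    refine ⟨SimpleGraph.Walk.cons (by simpa using hab) p, ?_, ?_⟩
    · rw [← hp]; simp
    · intro x y hxy
      rw [SimpleGraph.Walk.edges_cons, List.mem_cons] at hxy
      rcases hxy with h | h
      · rw [Sym2.eq_iff] at h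
        rcases h with ⟨rfl, rfl⟩ | ⟨rfl, rfl⟩
        exacts [h1, hs _ _ h1]
      · exact he _ _ h

theorem toMono {n : ℕ} (χ : Fin n → Fin n → ℕ) (hsymm : ∀ u v, χ u v = χ v u) (col : ℕ)
    {M : Multiset (Fin n)} (hn : M.Nodup) (h : Cyc (fun a b => χ a b = col) M) :
    IsMonoCycle χ col M.toFinset := by
  have hs : ∀ a b, χ a b = col → χ b a = col := fun a b h => by rw [hsymm, h]
  rcases h with rfl | ⟨a, rfl⟩ | ⟨a, b, hw, hba⟩
  · left; rfl
  · right; left; exact ⟨a, by simp⟩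
  obtain ⟨p, hp, he⟩ := hw.toWalk hs hn
  have hpath : p.IsPath := by
    rw [SimpleGraph.Walk.isPath_def]
    rw [← hp] at hn; exact hn
  cases p with
  | nil =>
    right; left
    refine ⟨a, ?_⟩
    rw [← hp]; simp
  | @cons _ c _ hadj q =>
    rw [SimpleGraph.Walk.cons_isPath_iff] at hpath
    have hab : b ≠ a := by
      rintro rfl
      exact hpath.2 q.end_mem_support
    by_cases hcb : c = b
    · subst hcb
      have hq : q = SimpleGraph.Walk.nil := by
        simpa using hpath.1
      subst hq
      right; right; left
      refine ⟨a, c, hab.symm, ?_, hs _ _ hba⟩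
      rw [← hp]; ext; simp
    · right; right; right
      refine ⟨b, SimpleGraph.Walk.cons (by simpa using hab)
        (SimpleGraph.Walk.cons hadj q), ?_, ?_, ?_⟩
      · rw [SimpleGraph.Walk.cons_isCycle_iff]
        refine ⟨(SimpleGraph.Walk.cons_isPath_iff _ _).2 hpath, ?_⟩
        rw [SimpleGraph.Walk.edges_cons, List.mem_cons]
        rintro (h | h)
        · rw [Sym2.eq_iff] at h
          rcases h with ⟨h, -⟩ | ⟨h, -⟩
          · exact hab h
          · exact hcb h.symm
        · exact hpath.2 (q.snd_mem_support_of_mem_edges h)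
      · rw [← hp]
        ext v
        simp only [SimpleGraph.Walk.support_cons, List.mem_toFinset, List.mem_cons,
          Multiset.mem_toFinset, Multiset.mem_coe]
        constructor
        · rintro (rfl | h)
          · exact Or.inr q.end_mem_support
          · exact h
        · exact Or.inr
      · intro x y hxy
        rw [SimpleGraph.Walk.edges_cons, List.mem_cons] at hxy
        rcases hxy with h | h
        · rw [Sym2.eq_iff] at h
          rcases h with ⟨rfl, rfl⟩ | ⟨rfl, rfl⟩
          exacts [hba, hs _ _ hba]
        · exact he _ _ h

theorem mono_blue {n : ℕ} (χ : Fin n → Fin n → ℕ) (hsymm : ∀ u v, χ u v = χ v u) (α β : ℕ)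
    (hβ : β ≠ α)
    (huniq : ∀ v u w, u ≠ v → w ≠ v → χ v u ≠ α → χ v w ≠ α → χ v u = χ v w)
    {a b : Fin n} {M : Multiset (Fin n)} (h : W (fun a b => ¬ χ a b = α) a b M) (hn : M.Nodup)
    (ha : ∃ u, u ≠ a ∧ χ a u = β) : W (fun a b => χ a b = β) a b M := by
  induction h with
  | one a => exact W.one a
  | @cons a b c M h1 h2 ih =>
    rw [Multiset.singleton_add, Multiset.nodup_cons] at hn
    have hab : a ≠ b := by rintro rfl; exact hn.1 h2.start_mem
    obtain ⟨u, hu, rfl⟩ := ha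
    have e := huniq a b u hab.symm hu h1 hβ
    exact W.cons e (ih hn.2 ⟨a, hab, by rw [hsymm, e]⟩)

end Lehel

theorem two_local_one_colour_sees_all (n : ℕ) (χ : Fin n → Fin n → ℕ)
    (hsymm : ∀ u v, χ u v = χ v u)
    (hloc : ∀ v : Fin n, ((Finset.univ.erase v).image (χ v)).card ≤ 2)
    (α : ℕ) (hsee : ∀ v : Fin n, ∃ u : Fin n, u ≠ v ∧ χ v u = α) :
    ∃ (S₁ S₂ : Finset (Fin n)) (β : ℕ), β ≠ α ∧
      IsMonoCycle χ α S₁ ∧ IsMonoCycle χ β S₂ ∧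
      Disjoint S₁ S₂ ∧ S₁ ∪ S₂ = Finset.univ := by
  have huniq : ∀ v u w, u ≠ v → w ≠ v → χ v u ≠ α → χ v w ≠ α → χ v u = χ v w := by
    intro v u w hu hw h1 h2
    by_contra hne
    obtain ⟨z, hz, hzα⟩ := hsee v
    have hsub : ({α, χ v u, χ v w} : Finset ℕ) ⊆ (Finset.univ.erase v).image (χ v) := by
      intro c hc
      simp only [Finset.mem_insert, Finset.mem_singleton] at hc
      rw [Finset.mem_image]
      rcases hc with rfl | rfl | rfl
      · exact ⟨z, by simp [hz], hzα⟩
      · exact ⟨u, by simp [hu], rfl⟩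
      · exact ⟨w, by simp [hw], rfl⟩
    have h3 : ({α, χ v u, χ v w} : Finset ℕ).card = 3 :=
      Finset.card_eq_three.2 ⟨_, _, _, h1.symm, h2.symm, hne, rfl⟩
    have := Finset.card_le_card hsub
    have := hloc v
    omega
  obtain ⟨M₁, M₂, e, c1, c2⟩ := Lehel.lehel (R := fun a b => χ a b = α)
    (fun a b h => by rw [hsymm, h]) (Finset.univ : Finset (Fin n)).val
  have hnd : (M₁ + M₂).Nodup := by rw [e]; exact Finset.univ.nodup
  obtain ⟨n1, n2, hd⟩ := Multiset.nodup_add.1 hnd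
  have key : ∃ β, β ≠ α ∧ Lehel.Cyc (fun a b => χ a b = β) M₂ := by
    rcases c2 with h | h | ⟨a, b, hw, hba⟩
    · exact ⟨α+1, by omega, Or.inl h⟩
    · exact ⟨α+1, by omega, Or.inr (Or.inl h)⟩
    · by_cases hab : b = a
      · subst hab
        refine ⟨α+1, by omega, Or.inr (Or.inl ⟨b, ?_⟩)⟩
        rcases hw.tail with ⟨h, -⟩ | ⟨c, M', -, h, rfl⟩
        · exact h
        · exfalso
          rw [Multiset.singleton_add, Multiset.nodup_cons] at n2
          exact n2.1 (h.rev (fun a b h h' => h (by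
            show χ a b = α
            rw [hsymm]; exact h'))).start_mem
      · refine ⟨χ b a, hba, Or.inr (Or.inr ⟨a, b, ?_, rfl⟩)⟩
        exact Lehel.mono_blue χ hsymm α _ hba huniq hw n2 ⟨b, hab, hsymm _ _⟩
  obtain ⟨β, hβ, c2'⟩ := key
  refine ⟨M₁.toFinset, M₂.toFinset, β, hβ, Lehel.toMono χ hsymm α n1 c1,
    Lehel.toMono χ hsymm β n2 c2', ?_, ?_⟩
  · rw [Finset.disjoint_left]
    intro v h1 h2
    rw [Multiset.mem_toFinset] at h1 h2
    exact Multiset.disjoint_left.1 hd h1 h2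
  · ext v
    have : v ∈ M₁ + M₂ := by rw [e]; simp
    simpa [Multiset.mem_add] using this
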